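/- Let 𝓕 be a stable and saturated family of 3-element subsets of [10] with ν(𝓕) = 2 and ν(𝓕(1̄)) = 2. Then |𝓕| ≤ 63. -/

import Mathlib

/-- The matching number of a family of finite sets: the maximum number of
pairwise disjoint nonempty members. -/
noncomputable def matchNum (𝓕 : Finset (Finset ℕ)) : ℕ :=
  sSup {m | ∃ M ⊆ 𝓕, M.card = m ∧ (∀ A ∈ M, A.Nonempty) ∧
    (M : Set (Finset ℕ)).Pairwise fun A B => Disjoint A B}

/-- A family of subsets of `[n] = {1,…,n}` is stable if it is closed downwards
under the "shifting" partial order: whenever `F ∈ 𝓕` and `G ⊆ [n]` admits a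
bijection `φ : F → G` with `φ x ≤ x` for all `x ∈ F`, then `G ∈ 𝓕`. -/
def Stable (n : ℕ) (𝓕 : Finset (Finset ℕ)) : Prop :=
  ∀ F ∈ 𝓕, ∀ G : Finset ℕ, G ⊆ Finset.Icc 1 n → G.card = F.card →
    (∃ φ : ℕ → ℕ, Set.BijOn φ (F : Set ℕ) (G : Set ℕ) ∧ ∀ x ∈ F, φ x ≤ x) → G ∈ 𝓕

/-- A family of `k`-element subsets of `[n]` is saturated if adding any new
`k`-element subset of `[n]` increases the matching number. -/
def Saturated (n k : ℕ) (𝓕 : Finset (Finset ℕ)) : Prop :=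
  ∀ E : Finset ℕ, E ⊆ Finset.Icc 1 n → E.card = k → E ∉ 𝓕 →
    matchNum 𝓕 < matchNum (insert E 𝓕)

theorem Finset.exists_lt_lt_of_card_eq_three {α : Type*} [LinearOrder α] {s : Finset α}
    (hs : s.card = 3) : ∃ a b c, a < b ∧ b < c ∧ s = {a, b, c} := by
  refine ⟨s.orderEmbOfFin hs 0, s.orderEmbOfFin hs 1, s.orderEmbOfFin hs 2, by simp, by simp, ?_⟩
  ext x
  rw [← Finset.mem_coe, ← Finset.range_orderEmbOfFin s hs, Set.mem_range]
  simp [Fin.exists_fin_succ, eq_comm]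

theorem bddAbove_card_matchings (𝓕 : Finset (Finset ℕ)) :
    BddAbove {m | ∃ M ⊆ 𝓕, M.card = m ∧ (∀ A ∈ M, A.Nonempty) ∧
      (M : Set (Finset ℕ)).Pairwise fun A B => Disjoint A B} := by
  refine ⟨𝓕.card, ?_⟩
  rintro m ⟨M, hM, rfl, -⟩
  exact Finset.card_le_card hM

theorem three_le_matchNum {𝓕 : Finset (Finset ℕ)} {A B C : Finset ℕ} (hA : A ∈ 𝓕) (hB : B ∈ 𝓕)
    (hC : C ∈ 𝓕) (hA0 : A.Nonempty) (hB0 : B.Nonempty) (hC0 : C.Nonempty) (hAB : Disjoint A B)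
    (hAC : Disjoint A C) (hBC : Disjoint B C) : 3 ≤ matchNum 𝓕 := by
  refine le_csSup (bddAbove_card_matchings 𝓕) ⟨{A, B, C}, ?_, ?_, ?_, ?_⟩
  · simp [Finset.insert_subset_iff, hA, hB, hC]
  · exact Finset.card_eq_three.2
      ⟨A, B, C, hAB.ne hA0.ne_empty, hAC.ne hA0.ne_empty, hBC.ne hB0.ne_empty, rfl⟩
  · simp [hA0, hB0, hC0]
  · intro X hX Y hY hXY
    simp only [Finset.coe_insert, Finset.coe_singleton, Set.mem_insert_iff,
      Set.mem_singleton_iff] at hX hY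
    rcases hX with rfl | rfl | rfl <;> rcases hY with rfl | rfl | rfl <;>
      first
        | exact absurd rfl hXY
        | assumption
        | exact Disjoint.symm ‹_›

theorem exists_disjoint_of_matchNum_eq_two {𝓕 : Finset (Finset ℕ)} (h : matchNum 𝓕 = 2) :
    ∃ A ∈ 𝓕, ∃ B ∈ 𝓕, Disjoint A B := by
  obtain ⟨M, hM, hcard, -, hdisj⟩ := Nat.sSup_mem
    (s := {m | ∃ M ⊆ 𝓕, M.card = m ∧ (∀ A ∈ M, A.Nonempty) ∧
      (M : Set (Finset ℕ)).Pairwise fun A B => Disjoint A B})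
    ⟨0, ∅, by simp, by simp, by simp, by simp⟩ (bddAbove_card_matchings 𝓕)
  obtain ⟨A, B, hAB, rfl⟩ := Finset.card_eq_two.1 (hcard.trans h)
  exact ⟨A, hM (by simp), B, hM (by simp), hdisj (by simp) (by simp) hAB⟩

namespace Stable

variable {n : ℕ} {𝓕 : Finset (Finset ℕ)}

theorem image_mem (hst : Stable n 𝓕) {F : Finset ℕ} (hF : F ∈ 𝓕) {φ : ℕ → ℕ}
    (hinj : Set.InjOn φ (F : Set ℕ)) (hle : ∀ x ∈ F, φ x ≤ x)
    (hsub : F.image φ ⊆ Finset.Icc 1 n) : F.image φ ∈ 𝓕 :=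
  hst F hF _ hsub (Finset.card_image_of_injOn hinj)
    ⟨φ, by simpa using hinj.bijOn_image, hle⟩

theorem triple_mem (hst : Stable n 𝓕) {a b c a' b' c' : ℕ} (h : ({a, b, c} : Finset ℕ) ∈ 𝓕)
    (hab : a < b) (hbc : b < c) (ha : a' ≤ a) (hb : b' ≤ b) (hc : c' ≤ c) (h1 : 1 ≤ a')
    (hab' : a' < b') (hbc' : b' < c') (hn : c' ≤ n) : ({a', b', c'} : Finset ℕ) ∈ 𝓕 := by
  let φ : ℕ → ℕ := fun x => if x = a then a' else if x = b then b' else c'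
  have hφa : φ a = a' := by simp [φ]
  have hφb : φ b = b' := by simp [φ, hab.ne']
  have hφc : φ c = c' := by simp [φ, hbc.ne', (hab.trans hbc).ne']
  have himage : ({a, b, c} : Finset ℕ).image φ = {a', b', c'} := by
    simp [Finset.image_insert, hφa, hφb, hφc]
  rw [← himage]
  refine hst.image_mem h ?_ ?_ ?_
  · intro x hx y hy hxy
    simp only [Finset.coe_insert, Finset.coe_singleton, Set.mem_insert_iff,
      Set.mem_singleton_iff] at hx hy
    rcases hx with rfl | rfl | rfl <;> rcases hy with rfl | rfl | rfl <;> grind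
  · simp [hφa, hφb, hφc, ha, hb, hc]
  · rw [himage]
    intro x hx
    simp only [Finset.mem_insert, Finset.mem_singleton, Finset.mem_Icc] at hx ⊢
    omega

/-- Two disjoint members avoiding `1` can be compressed into an initial segment of `{2, 3, …}`. -/
theorem exists_disjoint_subset_Icc (hst : Stable n 𝓕) {A B : Finset ℕ} (hA : A ∈ 𝓕) (hB : B ∈ 𝓕)
    (hAn : A ⊆ Finset.Icc 2 n) (hBn : B ⊆ Finset.Icc 2 n) (hAB : Disjoint A B) :
    ∃ A' ∈ 𝓕, ∃ B' ∈ 𝓕, A'.card = A.card ∧ B'.card = B.card ∧ Disjoint A' B' ∧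
      A' ⊆ Finset.Icc 2 (A.card + B.card + 1) ∧ B' ⊆ Finset.Icc 2 (A.card + B.card + 1) := by
  let S := A ∪ B
  let φ : ℕ → ℕ := fun x => (S.filter (· ≤ x)).card + 1
  have hS : S ⊆ Finset.Icc 2 n := Finset.union_subset hAn hBn
  have hle : ∀ x ∈ S, φ x ≤ x := by
    intro x hx
    have hsub : S.filter (· ≤ x) ⊆ Finset.Icc 2 x := by
      intro y hy
      have := Finset.mem_Icc.1 (hS (Finset.mem_filter.1 hy).1)
      exact Finset.mem_Icc.2 ⟨this.1, (Finset.mem_filter.1 hy).2⟩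
    have hcard := Finset.card_le_card hsub
    have hx2 := Finset.mem_Icc.1 (hS hx)
    rw [Nat.card_Icc] at hcard
    simp only [φ]
    omega
  have hmono : StrictMonoOn φ (S : Set ℕ) := by
    intro x _ y hy hxy
    refine Nat.succ_lt_succ (Finset.card_lt_card ?_)
    refine (Finset.ssubset_iff_of_subset fun z hz => ?_).2 ⟨y, ?_, ?_⟩
    · simp only [Finset.mem_filter] at hz ⊢
      exact ⟨hz.1, hz.2.trans hxy.le⟩
    · simpa using hy
    · simp [hxy]
  have hrange : ∀ x ∈ S, φ x ∈ Finset.Icc 2 (A.card + B.card + 1) := by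
    intro x hx
    have hpos : 0 < (S.filter (· ≤ x)).card :=
      Finset.card_pos.2 ⟨x, Finset.mem_filter.2 ⟨hx, le_rfl⟩⟩
    have hcard : (S.filter (· ≤ x)).card ≤ A.card + B.card :=
      (Finset.card_filter_le _ _).trans (Finset.card_union_le A B)
    simp only [φ, Finset.mem_Icc]
    omega
  have hAS : A ⊆ S := Finset.subset_union_left
  have hBS : B ⊆ S := Finset.subset_union_right
  have hmem : ∀ X ∈ 𝓕, X ⊆ S → X.image φ ∈ 𝓕 := by
    intro X hX hXS
    refine hst.image_mem hX (hmono.injOn.mono (Finset.coe_subset.2 hXS))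
      (fun x hx => hle x (hXS hx)) (Finset.image_subset_iff.2 fun x hx => ?_)
    have h1 := Finset.mem_Icc.1 (hrange x (hXS hx))
    have h2 := Finset.mem_Icc.1 (hS (hXS hx))
    have h3 := hle x (hXS hx)
    exact Finset.mem_Icc.2 ⟨by omega, by omega⟩
  have hcard : ∀ X ⊆ S, (X.image φ).card = X.card := fun X hXS =>
    Finset.card_image_of_injOn (hmono.injOn.mono (Finset.coe_subset.2 hXS))
  refine ⟨_, hmem A hA hAS, _, hmem B hB hBS, hcard A hAS, hcard B hBS, ?_,
    Finset.image_subset_iff.2 fun x hx => hrange x (hAS hx),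
    Finset.image_subset_iff.2 fun x hx => hrange x (hBS hx)⟩
  rw [Finset.disjoint_left]
  intro z hzA hzB
  obtain ⟨x, hx, rfl⟩ := Finset.mem_image.1 hzA
  obtain ⟨y, hy, hxy⟩ := Finset.mem_image.1 hzB
  have := hmono.injOn (hBS hy) (hAS hx) hxy
  exact Finset.disjoint_left.1 hAB hx (this ▸ hy)

/-- A stable family of triples missing every member of `L` has no member above a member of `L`
in the shifting order. -/
theorem card_le_of_forall_notMem (hst : Stable n 𝓕)
    (h𝓕 : 𝓕 ⊆ Finset.powersetCard 3 (Finset.Icc 1 n)) (L : List (ℕ × ℕ × ℕ))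
    (hL : ∀ t ∈ L, (1 ≤ t.1 ∧ t.1 < t.2.1 ∧ t.2.1 < t.2.2) ∧
      ({t.1, t.2.1, t.2.2} : Finset ℕ) ∉ 𝓕) :
    𝓕.card ≤ ((Finset.Icc 1 n ×ˢ Finset.Icc 1 n ×ˢ Finset.Icc 1 n).filter fun x =>
      x.1 < x.2.1 ∧ x.2.1 < x.2.2 ∧
        ∀ t ∈ L, ¬(t.1 ≤ x.1 ∧ t.2.1 ≤ x.2.1 ∧ t.2.2 ≤ x.2.2)).card := by
  refine (Finset.card_le_card fun F hF => ?_).trans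
    (Finset.card_image_le (f := fun x : ℕ × ℕ × ℕ => ({x.1, x.2.1, x.2.2} : Finset ℕ)))
  obtain ⟨hsub, hcard⟩ := Finset.mem_powersetCard.1 (h𝓕 hF)
  obtain ⟨a, b, c, hab, hbc, rfl⟩ := Finset.exists_lt_lt_of_card_eq_three hcard
  refine Finset.mem_image.2 ⟨(a, b, c), Finset.mem_filter.2 ⟨?_, hab, hbc, ?_⟩, rfl⟩
  · simp only [Finset.mem_product]
    exact ⟨hsub (by simp), hsub (by simp), hsub (by simp)⟩
  · rintro t ht ⟨ha, hb, hc⟩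
    obtain ⟨⟨h1, h2, h3⟩, hmem⟩ := hL t ht
    have hcn := (Finset.mem_Icc.1 (hsub (by simp : c ∈ ({a, b, c} : Finset ℕ)))).2
    exact hmem (hst.triple_mem hF hab hbc ha hb hc h1 h2 h3 (hc.trans hcn))

end Stable

/-- A stable, saturated family of 3-subsets of `[10]` with
`ν(𝓕) = ν(𝓕(1̄)) = 2` has at most 63 members. -/
theorem case_s_two (𝓕 : Finset (Finset ℕ))
    (h𝓕 : 𝓕 ⊆ Finset.powersetCard 3 (Finset.Icc 1 10))
    (hst : Stable 10 𝓕) (hsat : Saturated 10 3 𝓕) (hν : matchNum 𝓕 = 2)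
    (hν1 : matchNum (𝓕.filter fun F => 1 ∉ F) = 2) :
    𝓕.card ≤ 63 := by
  have hno : ∀ A ∈ 𝓕, ∀ B ∈ 𝓕, ∀ C ∈ 𝓕, Disjoint A B → Disjoint A C → ¬Disjoint B C := by
    intro A hA B hB C hC hAB hAC hBC
    have hne : ∀ X ∈ 𝓕, X.Nonempty := fun X hX => Finset.card_pos.1 <| by
      rw [(Finset.mem_powersetCard.1 (h𝓕 hX)).2]; decide
    have := three_le_matchNum hA hB hC (hne A hA) (hne B hB) (hne C hC) hAB hAC hBC
    omega
  obtain ⟨A, hA, B, hB, hAB⟩ := exists_disjoint_of_matchNum_eq_two hν1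
  rw [Finset.mem_filter] at hA hB
  have hsub : ∀ X ∈ 𝓕, 1 ∉ X → X ⊆ Finset.Icc 2 10 := by
    intro X hX h1 x hx
    have hx' := Finset.mem_Icc.1 ((Finset.mem_powersetCard.1 (h𝓕 hX)).1 hx)
    have : x ≠ 1 := fun h => h1 (h ▸ hx)
    exact Finset.mem_Icc.2 ⟨by omega, hx'.2⟩
  have hA3 := (Finset.mem_powersetCard.1 (h𝓕 hA.1)).2
  have hB3 := (Finset.mem_powersetCard.1 (h𝓕 hB.1)).2
  have h345 : ({3, 4, 5} : Finset ℕ) ∈ 𝓕 := by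
    have key : ∀ X ∈ 𝓕, X ⊆ Finset.Icc 2 10 → 2 ∉ X → ({3, 4, 5} : Finset ℕ) ∈ 𝓕 := by
      intro X hX hX2 h2
      obtain ⟨a, b, c, hab, hbc, rfl⟩ := Finset.exists_lt_lt_of_card_eq_three
        (Finset.mem_powersetCard.1 (h𝓕 hX)).2
      have ha := Finset.mem_Icc.1 (hX2 (by simp : a ∈ ({a, b, c} : Finset ℕ)))
      have ha2 : a ≠ 2 := by rintro rfl; simp at h2
      exact hst.triple_mem hX hab hbc (by omega) (by omega) (by omega) (by norm_num) (by norm_num)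
        (by norm_num) (by norm_num)
    by_cases h2 : 2 ∈ A
    · exact key B hB.1 (hsub B hB.1 hB.2) (Finset.disjoint_left.1 hAB h2)
    · exact key A hA.1 (hsub A hA.1 hA.2) h2
  have h189 : ({1, 8, 9} : Finset ℕ) ∉ 𝓕 := by
    intro h
    obtain ⟨A', hA', B', hB', -, -, hAB', hA7, hB7⟩ := hst.exists_disjoint_subset_Icc hA.1 hB.1
      (hsub A hA.1 hA.2) (hsub B hB.1 hB.2) hAB
    rw [hA3, hB3] at hA7 hB7
    have hd : Disjoint ({1, 8, 9} : Finset ℕ) (Finset.Icc 2 (3 + 3 + 1)) := by decide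
    exact hno _ h A' hA' B' hB' (hd.mono_right hA7) (hd.mono_right hB7) hAB'
  by_cases h368 : ({3, 6, 8} : Finset ℕ) ∈ 𝓕
  · have h257 : ({2, 5, 7} : Finset ℕ) ∈ 𝓕 := by apply hst.triple_mem h368 <;> norm_num
    have h149 : ({1, 4, 9} : Finset ℕ) ∉ 𝓕 := fun h =>
      hno _ h _ h257 _ h368 (by decide) (by decide) (by decide)
    exact (hst.card_le_of_forall_notMem h𝓕 [(1, 4, 9)] (by simp [*])).trans (by decide +kernel)
  by_cases h249 : ({2, 4, 9} : Finset ℕ) ∈ 𝓕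
  swap
  · exact (hst.card_le_of_forall_notMem h𝓕 [(1, 8, 9), (2, 4, 9), (3, 6, 8)] (by simp [*])).trans
      (by decide +kernel)
  by_cases h169 : ({1, 6, 9} : Finset ℕ) ∈ 𝓕
  · have h168 : ({1, 6, 8} : Finset ℕ) ∈ 𝓕 := by apply hst.triple_mem h169 <;> norm_num
    have h278 : ({2, 7, 8} : Finset ℕ) ∉ 𝓕 := fun h =>
      hno _ h _ h169 _ h345 (by decide) (by decide) (by decide)
    have h357 : ({3, 5, 7} : Finset ℕ) ∉ 𝓕 := fun h =>
      hno _ h _ h168 _ h249 (by decide) (by decide) (by decide)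
    exact (hst.card_le_of_forall_notMem h𝓕 [(1, 8, 9), (2, 7, 8), (3, 5, 7)] (by simp [*])).trans
      (by decide +kernel)
  by_cases h167 : ({1, 6, 7} : Finset ℕ) ∈ 𝓕
  · have h358 : ({3, 5, 8} : Finset ℕ) ∉ 𝓕 := fun h =>
      hno _ h _ h167 _ h249 (by decide) (by decide) (by decide)
    exact (hst.card_le_of_forall_notMem h𝓕 [(1, 6, 9), (3, 5, 8)] (by simp [*])).trans
      (by decide +kernel)
  · exact (hst.card_le_of_forall_notMem h𝓕 [(1, 6, 7)] (by simp [*])).trans (by decide +kernel)
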